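/- Let O be a non-trivial m-ovoid of the symplectic polar space W(2r−1,q), r > 2. Then m ≥ (−3 + √(9 + 4(q^r + q − 2)))/(2(q−1)). -/

import Mathlib

noncomputable section

open scoped BigOperators

namespace PolarOvoids

/-- The kind of the polar space `P'_{r,e}`: the elliptic quadric `Q⁻(2r+1,q)` (`e = 2`),
the symplectic polar space `W(2r-1,q)` (`e = 1`), or the Hermitian polar space `H(2r,q)`
with `q` a square (`e = 3/2`). -/
inductive PolarKind : Type where
  | elliptic
  | symplectic
  | hermitian

/-- The parameter `e` of the polar space. -/
def PolarKind.e : PolarKind → ℝ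
  | .elliptic => 2
  | .symplectic => 1
  | .hermitian => 3 / 2

/-- The dimension `2r + 2e - 2` of the vector space underlying the ambient projective
space `PG(n,q)`, `n = 2r + 2e - 3`. -/
def PolarKind.vdim : PolarKind → ℕ → ℕ
  | .elliptic, r => 2 * r + 2
  | .symplectic, r => 2 * r
  | .hermitian, r => 2 * r + 1

/-- The orthogonal complement (polar image) of a subspace with respect to a
(reflexive) sesquilinear form `B`. -/
def sperp {F V : Type} [Field F] [AddCommGroup V] [Module F V] {σ : F →+* F}
    (B : V →ₗ[F] V →ₛₗ[σ] F) (W : Submodule F V) : Submodule F V where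
  carrier := {v | ∀ w ∈ W, B w v = 0}
  add_mem' := by
    intro a b ha hb w hw
    simp only [map_add, ha w hw, hb w hw, add_zero]
  zero_mem' := by
    intro w hw
    simp
  smul_mem' := by
    intro c v hv w hw
    simp only [map_smulₛₗ, hv w hw, smul_zero]

/-- The set of points of the projective space `PG(n,q)` lying in a projective subspace,
given as the corresponding linear subspace `W`. -/
def pts {F V : Type} [Field F] [AddCommGroup V] [Module F V] (W : Submodule F V) :
    Set (Projectivization F V) := {p | p.rep ∈ W}

/-- The total weight `μ(S) = ∑_{p ∈ S} μ(p)` of a set `S` of projective points under a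
weight function `μ` on the points. -/
def wsum {F V : Type} [Field F] [AddCommGroup V] [Module F V]
    (μ : Projectivization F V → ℕ) (S : Set (Projectivization F V)) : ℝ :=
  ∑ᶠ p ∈ S, (μ p : ℝ)

/-- The weight `μ(S) = |S ∩ O|` of a point set `S` with respect to the point set `O`. -/
def nwt {X : Type} (O S : Set X) : ℝ := ((S ∩ O).ncard : ℝ)

/-- The defining property of each kind of polar space, in terms of the companion
automorphism `σ`, the sesquilinear form `B` inducing the polarity, the point set `sing`
of the polar space and the predicate `ti` of total isotropy (resp. total singularity):
* symplectic: `B` is a non-degenerate alternating bilinear form;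
* Hermitian: `B` is a non-degenerate Hermitian form with respect to the involutory field
  automorphism `σ` (so the field order is a square `q` and `σ : x ↦ x^√q`);
* elliptic: `B` is the bilinear form associated to a non-singular quadratic form `Q`,
  of Witt index `r` (imposed by the rank axioms below). -/
def PolarKind.Spec {F : Type} [Field F] {N : ℕ} :
    (k : PolarKind) → (σ : F →+* F) →
    ((Fin N → F) →ₗ[F] (Fin N → F) →ₛₗ[σ] F) →
    Set (Projectivization F (Fin N → F)) →
    (Submodule F (Fin N → F) → Prop) → Prop
  | .symplectic, σ, B, sing, ti =>
      σ = RingHom.id F ∧ (∀ v, B v v = 0) ∧ sing = Set.univ ∧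
        ∀ W, ti W ↔ ∀ v ∈ W, ∀ w ∈ W, B v w = 0
  | .hermitian, σ, B, sing, ti =>
      σ ≠ RingHom.id F ∧ σ.comp σ = RingHom.id F ∧
        (∀ v w, B w v = σ (B v w)) ∧
        sing = {p | B p.rep p.rep = 0} ∧
        ∀ W, ti W ↔ ∀ v ∈ W, ∀ w ∈ W, B v w = 0
  | .elliptic, σ, B, sing, ti =>
      σ = RingHom.id F ∧
        ∃ Q : QuadraticForm F (Fin N → F),
          (∀ v w, QuadraticMap.polar (⇑Q) v w = B v w) ∧
          sing = {p | Q p.rep = 0} ∧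
          ∀ W, ti W ↔ ∀ v ∈ W, Q v = 0

/-- A finite classical polar space `P'_{r,e}` of rank `r` and kind `k` over the finite
field `F` (of order `q`), consisting of the totally isotropic (resp. totally singular)
subspaces with respect to the defining form.  Its ambient projective space is
`PG(2r + 2e - 3, q)`, whose points are the points of `Projectivization F (Fin (k.vdim r) → F)`
and whose `j`-dimensional projective subspaces correspond to the linear subspaces
`W : Submodule F (Fin (k.vdim r) → F)` with `Module.finrank F W = j + 1`.
The polarity `⊥` of the ambient projective space is induced by the non-degenerate
reflexive (sesquilinear) form `B`; the rank axioms state that the Witt index is `r`,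
i.e. generators have projective dimension `r - 1`. -/
structure PolarSpace (F : Type) [Field F] (r : ℕ) (k : PolarKind) where
  σ : F →+* F
  B : (Fin (k.vdim r) → F) →ₗ[F] (Fin (k.vdim r) → F) →ₛₗ[σ] F
  nondeg : ∀ v, (∀ w, B v w = 0) → v = 0
  sing : Set (Projectivization F (Fin (k.vdim r) → F))
  ti : Submodule F (Fin (k.vdim r) → F) → Prop
  spec : k.Spec σ B sing ti
  rank_exists : ∃ W, ti W ∧ Module.finrank F ↥W = r
  rank_le : ∀ W, ti W → Module.finrank F ↥W ≤ r

namespace PolarSpace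

variable {F : Type} [Field F] {r : ℕ} {k : PolarKind}

/-- The image `π^⊥` of a subspace `π` under the polarity of the ambient projective space. -/
def perp (P : PolarSpace F r k) (W : Submodule F (Fin (k.vdim r) → F)) :
    Submodule F (Fin (k.vdim r) → F) := sperp P.B W

/-- The image `p^⊥` of a point `p` under the polarity of the ambient projective space. -/
def pperp (P : PolarSpace F r k) (p : Projectivization F (Fin (k.vdim r) → F)) :
    Submodule F (Fin (k.vdim r) → F) := sperp P.B (Submodule.span F {p.rep})

/-- A generator: a maximal totally isotropic (totally singular) subspace, i.e. one of
projective dimension `r - 1`. -/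
def IsGenerator (P : PolarSpace F r k) (W : Submodule F (Fin (k.vdim r) → F)) : Prop :=
  P.ti W ∧ Module.finrank F ↥W = r

/-- An `m`-ovoid: a set `O` of points of the polar space such that every generator
contains exactly `m` points of `O`. -/
def IsMOvoid (P : PolarSpace F r k) (m : ℕ)
    (O : Set (Projectivization F (Fin (k.vdim r) → F))) : Prop :=
  O ⊆ P.sing ∧ ∀ W, P.IsGenerator W → (pts W ∩ O).ncard = m

/-- A non-trivial `m`-ovoid: an `m`-ovoid with `0 < m < θ_{r-1} = (q^r - 1)/(q - 1)`,
the number of points of a generator. -/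
def IsNontrivialMOvoid [Fintype F] (P : PolarSpace F r k) (m : ℕ)
    (O : Set (Projectivization F (Fin (k.vdim r) → F))) : Prop :=
  P.IsMOvoid m O ∧ 0 < m ∧ m < ∑ i ∈ Finset.range r, Fintype.card F ^ i

/-- A weighted `m`-ovoid: a function `μ` assigning a natural number to each point of the
ambient projective space, vanishing on points not in the polar space, such that
`μ(p^⊥) + q^{r+e-2}·μ(p) = m·(q^{r+e-2} + 1)` for every point `p` of `PG(n,q)`. -/
def IsWeightedMOvoid [Fintype F] (P : PolarSpace F r k) (m : ℕ)
    (μ : Projectivization F (Fin (k.vdim r) → F) → ℕ) : Prop :=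
  (∀ p, p ∉ P.sing → μ p = 0) ∧
  ∀ p, wsum μ (pts (P.pperp p)) +
      (Fintype.card F : ℝ) ^ ((r : ℝ) + k.e - 2) * (μ p : ℝ)
    = (m : ℝ) * ((Fintype.card F : ℝ) ^ ((r : ℝ) + k.e - 2) + 1)

end PolarSpace

section BilinForm

variable {F V : Type} [Field F] [Fintype F] [AddCommGroup V] [Module F V] [Fintype V]

open Classical in
/-- The number of vectors of `U` outside a smaller subspace `W`. -/
theorem card_mem_and_notMem {W U : Submodule F V} (h : W ≤ U) {a b : ℕ}
    (hW : Module.finrank F W = a) (hU : Module.finrank F U = b) :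
    (((Finset.univ.filter fun w : V => w ∈ U ∧ w ∉ W).card : ℕ) : ℝ)
      = (Fintype.card F : ℝ) ^ b - (Fintype.card F : ℝ) ^ a := by
  have hc : ∀ S : Submodule F V, (Finset.univ.filter fun w : V => w ∈ S).card
      = Fintype.card F ^ Module.finrank F S := by
    intro S
    rw [← Module.card_eq_pow_finrank (K := F) (V := S), Fintype.card_subtype]
  have hs : (Finset.univ.filter fun w : V => w ∈ U ∧ w ∉ W)
      = (Finset.univ.filter fun w : V => w ∈ U) \ (Finset.univ.filter fun w : V => w ∈ W) := by
    ext w; simp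
  rw [hs, Finset.card_sdiff_of_subset, Nat.cast_sub, hc, hc, hW, hU]
  · push_cast; rfl
  · exact Finset.card_le_card fun w => by simpa using fun hw => h hw
  · exact fun w => by simpa using fun hw => h hw

omit [Fintype F] [Fintype V] in
/-- The exchange property for spans. -/
theorem mem_sup_span_singleton_comm {W : Submodule F V} {u w : V} (hu : u ∉ W)
    (h : u ∈ W ⊔ Submodule.span F {w}) : w ∈ W ⊔ Submodule.span F {u} := by
  obtain ⟨y, hy, z, hz, rfl⟩ := Submodule.mem_sup.1 h
  obtain ⟨c, rfl⟩ := Submodule.mem_span_singleton.1 hz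
  have hc : c ≠ 0 := by
    rintro rfl
    simp [hy] at hu
  refine Submodule.mem_sup.2 ⟨-(c⁻¹ • y), W.neg_mem (W.smul_mem _ hy), c⁻¹ • (y + c • w),
    Submodule.smul_mem _ _ (Submodule.mem_span_singleton_self _), ?_⟩
  rw [smul_add, inv_smul_smul₀ hc]
  abel

omit [Fintype F] [Fintype V] in
theorem mem_orthogonal_sup_span_singleton (B : LinearMap.BilinForm F V) (W : Submodule F V)
    (u w : V) : u ∈ B.orthogonal (W ⊔ Submodule.span F {w}) ↔ u ∈ B.orthogonal W ∧ B w u = 0 := by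
  constructor
  · exact fun h => ⟨LinearMap.BilinForm.orthogonal_le le_sup_left h,
      h w (Submodule.mem_sup_right (Submodule.mem_span_singleton_self w))⟩
  · rintro ⟨h1, h2⟩ v hv
    obtain ⟨y, hy, z, hz, rfl⟩ := Submodule.mem_sup.1 hv
    obtain ⟨c, rfl⟩ := Submodule.mem_span_singleton.1 hz
    have h3 : B y u = 0 := h1 y hy
    simp [h3, h2]

omit [Fintype F] [Fintype V] in
theorem sup_span_singleton_le_orthogonal {B : LinearMap.BilinForm F V} (hA : B.IsAlt)
    {W : Submodule F V} (hW : W ≤ B.orthogonal W) {w : V} (hw : w ∈ B.orthogonal W) :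
    W ⊔ Submodule.span F {w} ≤ B.orthogonal (W ⊔ Submodule.span F {w}) := by
  refine sup_le (fun u hu => ?_) ?_
  · refine (mem_orthogonal_sup_span_singleton B W u w).2 ⟨hW hu, ?_⟩
    exact hA.isRefl u w (hw u hu)
  · rw [Submodule.span_singleton_le_iff_mem]
    exact (mem_orthogonal_sup_span_singleton B W w w).2 ⟨hw, hA w⟩

open Classical in
theorem card_extensions_orthogonal {B : LinearMap.BilinForm F V} (hB : B.Nondegenerate)
    (hA : B.IsAlt) {r k n : ℕ} (hV : Module.finrank F V = 2 * r) (hk : k + (n + 1) = r)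
    {W : Submodule F V} (hW : W ≤ B.orthogonal W) (hd : Module.finrank F W = k) (u : V) :
    (((Finset.univ.filter fun w : V => (w ∈ B.orthogonal W ∧ w ∉ W) ∧
      u ∈ B.orthogonal (W ⊔ Submodule.span F {w})).card : ℕ) : ℝ)
      = (if u ∈ B.orthogonal W then
          (Fintype.card F : ℝ) ^ (k + 2 * n + 1) - (Fintype.card F : ℝ) ^ k else 0)
        + if u ∈ W then
          (Fintype.card F : ℝ) ^ (k + 2 * n + 2) - (Fintype.card F : ℝ) ^ (k + 2 * n + 1)
          else 0 := by
  have ho : Module.finrank F (B.orthogonal W) = k + 2 * n + 2 := by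
    rw [LinearMap.BilinForm.finrank_orthogonal hB, hV, hd]; omega
  by_cases hu : u ∈ W
  · have hs : (Finset.univ.filter fun w : V => (w ∈ B.orthogonal W ∧ w ∉ W) ∧
        u ∈ B.orthogonal (W ⊔ Submodule.span F {w}))
        = Finset.univ.filter fun w : V => w ∈ B.orthogonal W ∧ w ∉ W := by
      ext w
      simp only [Finset.mem_filter, Finset.mem_univ, true_and, and_iff_left_iff_imp]
      rintro ⟨hw, -⟩
      exact (mem_orthogonal_sup_span_singleton B W u w).2 ⟨hW hu, hA.isRefl u w (hw u hu)⟩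
    rw [hs, card_mem_and_notMem hW hd ho, if_pos hu, if_pos (hW hu)]
    ring
  by_cases hu' : u ∈ B.orthogonal W
  · have hd' : Module.finrank F ↥(W ⊔ Submodule.span F {u}) = k + 1 := by
      rw [Submodule.finrank_sup_span_singleton hu, hd]
    have ho' : Module.finrank F (B.orthogonal (W ⊔ Submodule.span F {u})) = k + 2 * n + 1 := by
      rw [LinearMap.BilinForm.finrank_orthogonal hB, hV, hd']; omega
    have hs : (Finset.univ.filter fun w : V => (w ∈ B.orthogonal W ∧ w ∉ W) ∧
        u ∈ B.orthogonal (W ⊔ Submodule.span F {w}))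
        = Finset.univ.filter fun w : V =>
          w ∈ B.orthogonal (W ⊔ Submodule.span F {u}) ∧ w ∉ W := by
      ext w
      simp only [Finset.mem_filter, Finset.mem_univ, true_and, mem_orthogonal_sup_span_singleton]
      have := hA.isRefl u w
      have := hA.isRefl w u
      tauto
    rw [hs, card_mem_and_notMem (le_trans le_sup_left (sup_span_singleton_le_orthogonal hA hW hu'))
      hd ho', if_neg hu, if_pos hu', add_zero]
  · rw [if_neg hu, if_neg hu', add_zero, Nat.cast_eq_zero, Finset.card_eq_zero,
      Finset.filter_eq_empty_iff]
    rintro w - ⟨-, h⟩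
    exact hu' ((mem_orthogonal_sup_span_singleton B W u w).1 h).1

open Classical in
theorem card_extensions_mem {B : LinearMap.BilinForm F V} (hB : B.Nondegenerate) {r k n : ℕ}
    (hV : Module.finrank F V = 2 * r) (hk : k + (n + 1) = r)
    {W : Submodule F V} (hW : W ≤ B.orthogonal W) (hd : Module.finrank F W = k) (u : V) :
    (((Finset.univ.filter fun w : V => (w ∈ B.orthogonal W ∧ w ∉ W) ∧
      u ∈ W ⊔ Submodule.span F {w}).card : ℕ) : ℝ)
      = (if u ∈ B.orthogonal W then
          (Fintype.card F : ℝ) ^ (k + 1) - (Fintype.card F : ℝ) ^ k else 0)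
        + if u ∈ W then
          (Fintype.card F : ℝ) ^ (k + 2 * n + 2) - (Fintype.card F : ℝ) ^ (k + 1)
          else 0 := by
  have ho : Module.finrank F (B.orthogonal W) = k + 2 * n + 2 := by
    rw [LinearMap.BilinForm.finrank_orthogonal hB, hV, hd]; omega
  by_cases hu : u ∈ W
  · have hs : (Finset.univ.filter fun w : V => (w ∈ B.orthogonal W ∧ w ∉ W) ∧
        u ∈ W ⊔ Submodule.span F {w})
        = Finset.univ.filter fun w : V => w ∈ B.orthogonal W ∧ w ∉ W := by
      ext w
      simp only [Finset.mem_filter, Finset.mem_univ, true_and, and_iff_left_iff_imp]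
      exact fun _ => Submodule.mem_sup_left hu
    rw [hs, card_mem_and_notMem hW hd ho, if_pos hu, if_pos (hW hu)]
    ring
  by_cases hu' : u ∈ B.orthogonal W
  · have hd' : Module.finrank F ↥(W ⊔ Submodule.span F {u}) = k + 1 := by
      rw [Submodule.finrank_sup_span_singleton hu, hd]
    have hs : (Finset.univ.filter fun w : V => (w ∈ B.orthogonal W ∧ w ∉ W) ∧
        u ∈ W ⊔ Submodule.span F {w})
        = Finset.univ.filter fun w : V => w ∈ W ⊔ Submodule.span F {u} ∧ w ∉ W := by
      ext w
      simp only [Finset.mem_filter, Finset.mem_univ, true_and]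
      constructor
      · rintro ⟨⟨-, hw⟩, h⟩
        exact ⟨mem_sup_span_singleton_comm hu h, hw⟩
      · rintro ⟨h, hw⟩
        exact ⟨⟨sup_le hW ((Submodule.span_singleton_le_iff_mem _ _).2 hu') h, hw⟩,
          mem_sup_span_singleton_comm hw h⟩
    rw [hs, card_mem_and_notMem le_sup_left hd hd', if_neg hu, if_pos hu', add_zero]
  · rw [if_neg hu, if_neg hu', add_zero, Nat.cast_eq_zero, Finset.card_eq_zero,
      Finset.filter_eq_empty_iff]
    rintro w - ⟨⟨hw, -⟩, h⟩
    exact hu' (sup_le hW ((Submodule.span_singleton_le_iff_mem _ _).2 hw) h)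

open Classical in
/-- If all totally isotropic subspaces of maximal dimension `r` have the same weight `M`, then
the weight of `W^⊥` is determined by the weight of `W`, for every totally isotropic `W`. -/
theorem sum_orthogonal {B : LinearMap.BilinForm F V} (hB : B.Nondegenerate) (hA : B.IsAlt)
    {r : ℕ} (hV : Module.finrank F V = 2 * r) (f : V → ℝ) (M : ℝ)
    (hM : ∀ W : Submodule F V, W ≤ B.orthogonal W → Module.finrank F W = r →
      ∑ u with u ∈ W, f u = M) (n : ℕ) :
    ∀ (k : ℕ) (W : Submodule F V), k + n = r → W ≤ B.orthogonal W → Module.finrank F W = k →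
      ∑ u with u ∈ B.orthogonal W, f u
        = M * ((Fintype.card F : ℝ) ^ n + 1) - (Fintype.card F : ℝ) ^ n * ∑ u with u ∈ W, f u := by
  induction n with
  | zero =>
    intro k W hk hW hd
    have he : W = B.orthogonal W := by
      refine Submodule.eq_of_le_of_finrank_eq hW ?_
      rw [LinearMap.BilinForm.finrank_orthogonal hB, hV, hd]; omega
    rw [← he, hM W hW (by omega)]
    ring
  | succ n ih =>
    intro k W hk hW hd
    set q : ℝ := (Fintype.card F : ℝ) with hq
    have hq1 : 1 < q := by
      rw [hq]; exact_mod_cast Fintype.one_lt_card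
    set D : Finset V := Finset.univ.filter fun w : V => w ∈ B.orthogonal W ∧ w ∉ W with hD
    have hstep : ∀ w ∈ D, ∑ u with u ∈ B.orthogonal (W ⊔ Submodule.span F {w}), f u
        = M * (q ^ n + 1) - q ^ n * ∑ u with u ∈ W ⊔ Submodule.span F {w}, f u := by
      intro w hw
      simp only [hD, Finset.mem_filter, Finset.mem_univ, true_and] at hw
      exact ih (k + 1) _ (by omega) (sup_span_singleton_le_orthogonal hA hW hw.1)
        (by rw [Submodule.finrank_sup_span_singleton hw.2, hd])
    have hswap : ∀ p : V → V → Prop, ∑ w ∈ D, ∑ u with p w u, f u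
        = ∑ u, f u * ((Finset.univ.filter fun w : V =>
            (w ∈ B.orthogonal W ∧ w ∉ W) ∧ p w u).card : ℝ) := by
      intro p
      simp_rw [Finset.sum_filter]
      rw [Finset.sum_comm]
      refine Finset.sum_congr rfl fun u _ => ?_
      rw [← Finset.sum_filter, Finset.sum_const, hD, Finset.filter_filter, nsmul_eq_mul, mul_comm]
    have h1 := hswap fun w u => u ∈ B.orthogonal (W ⊔ Submodule.span F {w})
    have h2 := hswap fun w u => u ∈ W ⊔ Submodule.span F {w}
    have hlin : ∀ a b : ℝ, ∑ u, f u * ((if u ∈ B.orthogonal W then a else 0)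
        + if u ∈ W then b else 0)
        = a * ∑ u with u ∈ B.orthogonal W, f u + b * ∑ u with u ∈ W, f u := by
      intro a b
      simp_rw [mul_add, Finset.sum_add_distrib, Finset.sum_filter, Finset.mul_sum]
      congr 1 <;> refine Finset.sum_congr rfl fun u _ => ?_ <;> split_ifs <;> ring
    simp_rw [card_extensions_orthogonal hB hA hV hk hW hd] at h1
    simp_rw [card_extensions_mem hB hV hk hW hd] at h2
    rw [hlin] at h1 h2
    have hcD : (D.card : ℝ) = q ^ (k + 2 * n + 2) - q ^ k :=
      card_mem_and_notMem hW hd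
        (by rw [LinearMap.BilinForm.finrank_orthogonal hB, hV, hd]; omega)
    rw [Finset.sum_congr rfl hstep, Finset.sum_sub_distrib, Finset.sum_const, nsmul_eq_mul, hcD,
      ← Finset.mul_sum, h2] at h1
    have hk0 : q ^ k ≠ 0 := by positivity
    have hn1 : q ^ n * q - 1 ≠ 0 := by
      have : 1 < q ^ (n + 1) := one_lt_pow₀ hq1 (by omega)
      rw [pow_succ] at this
      linarith
    have hn2 : q ^ n + 1 ≠ 0 := by positivity
    refine mul_left_cancel₀ (mul_ne_zero (mul_ne_zero hk0 hn1) hn2) ?_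
    simp only [← hq, pow_add, pow_mul', pow_one] at h1 ⊢
    linear_combination -h1

omit [Fintype V] in
open Classical in
theorem card_filter_eq_mul (B : LinearMap.BilinForm F V) {A : Finset V}
    (hsmul : ∀ c : F, c ≠ 0 → ∀ u ∈ A, c • u ∈ A) (u : V) {c : F} (hc : c ≠ 0) :
    ((Fintype.card F : ℝ) - 1) * ((A.filter fun a => B a u = c).card : ℝ)
      = (A.card : ℝ) - ((A.filter fun a => B a u = 0).card : ℝ) := by
  have hle : ∀ d e : F, d ≠ 0 → e ≠ 0 →
      (A.filter fun a => B a u = d).card ≤ (A.filter fun a => B a u = e).card := by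
    intro d e hd he
    refine Finset.card_le_card_of_injOn (fun a => (e * d⁻¹) • a) ?_ ?_
    · intro a ha
      simp only [Finset.coe_filter, Set.mem_ofPred_eq] at ha ⊢
      refine ⟨hsmul _ (mul_ne_zero he (inv_ne_zero hd)) _ ha.1, ?_⟩
      simp [ha.2, hd]
    · exact (smul_right_injective V (mul_ne_zero he (inv_ne_zero hd))).injOn
  have hfib : A.card = ∑ d : F, (A.filter fun a => B a u = d).card :=
    Finset.card_eq_sum_card_fiberwise fun a _ => Finset.mem_coe.2 (Finset.mem_univ _)
  rw [← Finset.add_sum_erase _ _ (Finset.mem_univ (0 : F)), Finset.sum_congr rfl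
    (fun d hd => le_antisymm (hle d c (Finset.ne_of_mem_erase hd) hc)
      (hle c d hc (Finset.ne_of_mem_erase hd))), Finset.sum_const,
    Finset.card_erase_of_mem (Finset.mem_univ _), Finset.card_univ, smul_eq_mul] at hfib
  have hpos : 1 ≤ Fintype.card F := Fintype.card_pos
  have := congrArg (Nat.cast : ℕ → ℝ) hfib
  push_cast [Nat.cast_sub hpos] at this
  linarith

omit [Fintype V] in
open Classical in
/-- The Cayley graph on `V` of a set meeting the hyperplanes `w^⊥` in two sizes is strongly regular
of negative Latin square type; this is the number of common neighbours of `0` and an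
adjacent `v`. -/
theorem card_common_neighbours {B : LinearMap.BilinForm F V} (hA : B.IsAlt) {A : Finset V}
    (hsmul : ∀ c : F, c ≠ 0 → ∀ u ∈ A, c • u ∈ A) (h0 : (0 : V) ∉ A) {q Q g : ℝ}
    (hq : q = (Fintype.card F : ℝ)) (hQ : Q ≠ 0) (hK : (A.card : ℝ) = g * (q * Q + 1))
    (hS : ∀ w : V, w ≠ 0 → ((A.filter fun u => B w u = 0).card : ℝ)
      = g * (Q + 1) - if w ∈ A then (q - 1) * Q else 0) {v : V} (hv : v ∈ A) :
    ((A.filter fun a => v - a ∈ A).card : ℝ) = g ^ 2 + 3 * g - q * Q := by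
  have hq1 : q - 1 ≠ 0 := by
    have : (1 : ℝ) < Fintype.card F := by exact_mod_cast Fintype.one_lt_card
    rw [hq]; linarith
  have hne : ∀ u ∈ A, u ≠ 0 := fun u hu h => h0 (h ▸ hu)
  have hcomm : ∀ a u : V, B a u = 0 ↔ B u a = 0 := fun a u => ⟨hA.isRefl a u, hA.isRefl u a⟩
  set S₁ : ℝ := g * (Q + 1) - (q - 1) * Q with hS₁
  have hSA : ∀ u ∈ A, ((A.filter fun a => B a u = 0).card : ℝ) = S₁ := by
    intro u hu
    simp_rw [fun a => hcomm a u]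
    rw [hS u (hne u hu), if_pos hu]
  have hcount : ∀ u ∈ A, ((A.filter fun a => B (v - a) u = 0).card : ℝ)
      = if B v u = 0 then S₁ else Q * (g + 1) := by
    intro u hu
    have he : (A.filter fun a => B (v - a) u = 0) = A.filter fun a => B a u = B v u := by
      ext a
      rw [Finset.mem_filter, Finset.mem_filter, map_sub, LinearMap.sub_apply, sub_eq_zero,
        eq_comm (a := B v u)]
    rw [he]
    split_ifs with h
    · rw [h, hSA u hu]
    · refine mul_left_cancel₀ hq1 ?_
      have := card_filter_eq_mul B hsmul u h
      rw [← hq, hK, hSA u hu] at this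
      rw [this, hS₁]
      ring
  have hleft : ∑ a ∈ A, ((A.filter fun u => B (v - a) u = 0).card : ℝ)
      = S₁ * S₁ + (A.card - S₁) * (Q * (g + 1)) := by
    have hswap : ∑ a ∈ A, ((A.filter fun u => B (v - a) u = 0).card : ℝ)
        = ∑ u ∈ A, ((A.filter fun a => B (v - a) u = 0).card : ℝ) := by
      simp_rw [Finset.card_filter, Nat.cast_sum]
      exact Finset.sum_comm
    have hvS : ((A.filter fun u => B v u = 0).card : ℝ) = S₁ := by
      rw [hS v (hne v hv), if_pos hv]
    have hsplit := Finset.card_filter_add_card_filter_not (s := A) (fun u => B v u = 0)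
    have hsplit' : ((A.filter fun u => B v u = 0).card : ℝ)
        + ((A.filter fun u => ¬ B v u = 0).card : ℝ) = A.card := by exact_mod_cast hsplit
    rw [hswap, Finset.sum_congr rfl hcount, Finset.sum_ite, Finset.sum_const, Finset.sum_const,
      nsmul_eq_mul, nsmul_eq_mul, ← hsplit', hvS]
    ring
  have hright : ∑ a ∈ A, ((A.filter fun u => B (v - a) u = 0).card : ℝ)
      = A.card + (A.card - 1) * (g * (Q + 1))
        - (q - 1) * Q * ((A.filter fun a => v - a ∈ A).card : ℝ) := by
    have hterm : ∀ a ∈ A, ((A.filter fun u => B (v - a) u = 0).card : ℝ)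
        = g * (Q + 1) + (if v = a then A.card - g * (Q + 1) else 0)
          - if v - a ∈ A then (q - 1) * Q else 0 := by
      intro a ha
      by_cases h : v = a
      · subst h
        simp [h0]
      · rw [hS _ (sub_ne_zero.2 h), if_neg h, add_zero]
    rw [Finset.sum_congr rfl hterm, Finset.sum_sub_distrib, Finset.sum_add_distrib,
      Finset.sum_const, Finset.sum_ite_eq, if_pos hv, ← Finset.sum_filter, Finset.sum_const,
      nsmul_eq_mul, nsmul_eq_mul]
    ring
  rw [hleft, hK, hS₁] at hright
  refine mul_left_cancel₀ (mul_ne_zero hq1 hQ) ?_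
  linear_combination hright

omit [Fintype V] in
open Classical in
theorem card_sub_two_le_card_common_neighbours {A : Finset V}
    (hsmul : ∀ c : F, c ≠ 0 → ∀ u ∈ A, c • u ∈ A) {v : V} (hv0 : v ≠ 0) (hv : v ∈ A) :
    (Fintype.card F : ℝ) - 2 ≤ ((A.filter fun a => v - a ∈ A).card : ℝ) := by
  have h : ((Finset.univ.erase (0 : F)).erase 1).card ≤ (A.filter fun a => v - a ∈ A).card := by
    refine Finset.card_le_card_of_injOn (fun c : F => c • v) ?_ (smul_left_injective F hv0).injOn
    intro c hc
    simp only [Finset.coe_erase, Finset.coe_univ, Set.mem_sdiff, Set.mem_univ, true_and,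
      Set.mem_singleton_iff, Finset.coe_filter, Set.mem_ofPred_eq] at hc ⊢
    refine ⟨hsmul c hc.1 v hv, ?_⟩
    have : v - c • v = (1 - c) • v := by rw [sub_smul, one_smul]
    rw [this]
    exact hsmul _ (sub_ne_zero.2 (Ne.symm hc.2)) v hv
  rw [Finset.card_erase_of_mem (by simp), Finset.card_erase_of_mem (Finset.mem_univ _),
    Finset.card_univ] at h
  have : Fintype.card F ≤ (A.filter fun a => v - a ∈ A).card + 2 := by omega
  have : (Fintype.card F : ℝ) ≤ (A.filter fun a => v - a ∈ A).card + 2 := by exact_mod_cast this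
  linarith

/-- A scaling-invariant set of non-zero vectors having `g > 0` elements in every maximal totally
isotropic subspace satisfies `q ^ r + q - 2 ≤ g ^ 2 + 3 g`. -/
theorem pow_add_sub_two_le {B : LinearMap.BilinForm F V} (hB : B.Nondegenerate) (hA : B.IsAlt)
    {r : ℕ} (hr : 0 < r) (hV : Module.finrank F V = 2 * r) {A : Finset V}
    (hsmul : ∀ c : F, c ≠ 0 → ∀ u ∈ A, c • u ∈ A) (h0 : (0 : V) ∉ A) {g : ℝ} (hg : 0 < g)
    (hM : ∀ W : Submodule F V, W ≤ B.orthogonal W → Module.finrank F W = r →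
      ((Set.ncard {u | u ∈ A ∧ u ∈ W} : ℕ) : ℝ) = g) :
    (Fintype.card F : ℝ) ^ r + Fintype.card F - 2 ≤ g ^ 2 + 3 * g := by
  classical
  obtain ⟨s, rfl⟩ : ∃ s, r = s + 1 := ⟨r - 1, by omega⟩
  have hq1 : (1 : ℝ) < Fintype.card F := by exact_mod_cast Fintype.one_lt_card
  have hsum : ∀ U : Submodule F V, ∑ u with u ∈ U, (if u ∈ A then (1 : ℝ) else 0)
      = ((A.filter fun u => u ∈ U).card : ℝ) := by
    intro U
    rw [← Finset.sum_filter, Finset.sum_const, nsmul_eq_mul, mul_one, Finset.filter_filter]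
    congr 2
    ext u
    simp [and_comm]
  have key := sum_orthogonal hB hA hV (fun u => if u ∈ A then (1 : ℝ) else 0) g (by
    intro W hW hd
    rw [hsum, ← hM W hW hd, ← Set.ncard_coe_finset]
    simp)
  simp_rw [hsum] at key
  have hK : (A.card : ℝ) = g * (Fintype.card F * (Fintype.card F : ℝ) ^ s + 1) := by
    have := key (s + 1) 0 ⊥ (by omega) bot_le (finrank_bot F V)
    have hbot : A.filter (fun u => u ∈ (⊥ : Submodule F V)) = ∅ := by
      refine Finset.filter_eq_empty_iff.2 fun u hu h => h0 ?_
      rwa [(Submodule.mem_bot F).1 h] at hu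
    rw [hbot] at this
    simpa [pow_succ'] using this
  have hS : ∀ w : V, w ≠ 0 → ((A.filter fun u => B w u = 0).card : ℝ)
      = g * ((Fintype.card F : ℝ) ^ s + 1)
        - if w ∈ A then ((Fintype.card F : ℝ) - 1) * (Fintype.card F : ℝ) ^ s else 0 := by
    intro w hw
    have horth : ∀ u, u ∈ B.orthogonal (Submodule.span F {w}) ↔ B w u = 0 := by
      intro u
      simpa using mem_orthogonal_sup_span_singleton B ⊥ u w
    have hiso : Submodule.span F {w} ≤ B.orthogonal (Submodule.span F {w}) := by
      rw [Submodule.span_singleton_le_iff_mem, horth]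
      exact hA w
    have := key s 1 _ (by omega) hiso (finrank_span_singleton hw)
    simp_rw [horth] at this
    rw [this]
    split_ifs with h
    · have hc : A.filter (fun u => u ∈ Submodule.span F {w})
          = (Finset.univ.erase (0 : F)).image fun c => c • w := by
        ext u
        simp only [Finset.mem_filter, Submodule.mem_span_singleton, Finset.mem_image,
          Finset.mem_erase, Finset.mem_univ, and_true]
        constructor
        · rintro ⟨hu, c, rfl⟩
          refine ⟨c, ?_, rfl⟩
          rintro rfl
          exact h0 (by simpa using hu)
        · rintro ⟨c, hc, rfl⟩
          exact ⟨hsmul c hc w h, c, rfl⟩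
      rw [hc, Finset.card_image_of_injective _ (smul_left_injective F hw),
        Finset.card_erase_of_mem (Finset.mem_univ _), Finset.card_univ,
        Nat.cast_sub Fintype.card_pos]
      push_cast
      ring
    · have hc : A.filter (fun u => u ∈ Submodule.span F {w}) = ∅ := by
        refine Finset.filter_eq_empty_iff.2 fun u hu hu' => h ?_
        obtain ⟨c, rfl⟩ := Submodule.mem_span_singleton.1 hu'
        have hc : c ≠ 0 := by
          rintro rfl
          exact h0 (by simpa using hu)
        simpa [hc] using hsmul c⁻¹ (inv_ne_zero hc) _ hu
      rw [hc]
      simp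
  have hpos : (0 : ℝ) < A.card := by
    rw [hK]; positivity
  obtain ⟨v, hv⟩ := Finset.card_pos.1 (by exact_mod_cast hpos)
  have h1 := card_common_neighbours hA hsmul h0 rfl (by positivity) hK hS hv
  have h2 := card_sub_two_le_card_common_neighbours hsmul (fun h => h0 (h ▸ hv)) hv
  rw [h1] at h2
  rw [pow_succ']
  linarith

/-- The non-zero vectors spanning a point of `O`. -/
def cone (O : Set (Projectivization F V)) : Set V :=
  {v | ∃ h : v ≠ 0, Projectivization.mk F v h ∈ O}

omit [Fintype F] [Fintype V] in
theorem smul_mem_cone {O : Set (Projectivization F V)} {c : F} (hc : c ≠ 0) {v : V}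
    (hv : v ∈ cone O) : c • v ∈ cone O := by
  obtain ⟨h, hO⟩ := hv
  refine ⟨smul_ne_zero hc h, ?_⟩
  rwa [(Projectivization.mk_eq_mk_iff' F (c • v) v _ h).2 ⟨c, rfl⟩]

omit [Fintype V] in
theorem ncard_cone_inter (O : Set (Projectivization F V)) (W : Submodule F V) :
    Set.ncard {u | u ∈ cone O ∧ u ∈ W} = (pts W ∩ O).ncard * (Fintype.card F - 1) := by
  classical
  have hF : (Set.univ : Set Fˣ).ncard = Fintype.card F - 1 := by
    rw [Set.ncard_univ, Nat.card_eq_fintype_card, Fintype.card_units]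
  rw [← hF, ← Set.ncard_prod]
  symm
  refine Set.ncard_congr (fun x _ => x.2 • x.1.rep) ?_ ?_ ?_
  · rintro ⟨p, c⟩ ⟨⟨hpW, hpO⟩, -⟩
    refine ⟨smul_mem_cone c.ne_zero ⟨p.rep_nonzero, ?_⟩, W.smul_mem (c : F) hpW⟩
    rwa [p.mk_rep]
  · rintro ⟨p, c⟩ ⟨p', c'⟩ - - h
    have hp : p = p' := by
      rw [← p.mk_rep, ← p'.mk_rep, Projectivization.mk_eq_mk_iff]
      refine ⟨c⁻¹ * c', ?_⟩
      rw [mul_smul, ← h, inv_smul_smul]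
    subst hp
    have := smul_left_injective F p.rep_nonzero h
    exact Prod.ext rfl (Units.ext this)
  · rintro u ⟨⟨hu, hO⟩, hW⟩
    obtain ⟨a, ha⟩ := Projectivization.exists_smul_eq_mk_rep F u hu
    refine ⟨(Projectivization.mk F u hu, a⁻¹), ⟨⟨?_, hO⟩, Set.mem_univ _⟩, ?_⟩
    · change (Projectivization.mk F u hu).rep ∈ W
      rw [← ha]
      exact W.smul_mem (a : F) hW
    · simp [← ha]

end BilinForm

/-- Theorem 4.3(2): if `O` is a non-trivial `m`-ovoid of the symplectic
polar space `W(2r−1,q)`, `r > 2`, then `m ≥ (−3 + √(9 + 4(q^r + q − 2)))/(2(q−1))`. -/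
theorem symplectic_ovoid_lower_bound
    {F : Type} [Field F] [Fintype F] {q r m : ℕ} (hq : Fintype.card F = q)
    (hr : 2 < r) (P : PolarSpace F r PolarKind.symplectic)
    (O : Set (Projectivization F (Fin (PolarKind.symplectic.vdim r) → F)))
    (hO : P.IsNontrivialMOvoid m O) :
    (m : ℝ) ≥ (-3 + Real.sqrt (9 + 4 * ((q : ℝ) ^ r + (q : ℝ) - 2)))
        / (2 * ((q : ℝ) - 1)) := by
  classical
  subst hq
  obtain ⟨⟨-, hO⟩, hm, -⟩ := hO
  obtain ⟨σ, B, nondeg, sing, ti, ⟨hσ, hA, _, hti⟩, _, _⟩ := P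
  subst hσ
  have hq1 : (1 : ℝ) < Fintype.card F := by exact_mod_cast Fintype.one_lt_card
  have hm' : (0 : ℝ) < m := by exact_mod_cast hm
  have hAlt : LinearMap.BilinForm.IsAlt B := hA
  have hB : LinearMap.BilinForm.Nondegenerate B :=
    ⟨nondeg, fun v h => nondeg v fun w => hAlt.isRefl w v (h w)⟩
  have hbound := pow_add_sub_two_le hB hAlt (r := r) (by omega)
    (by rw [Module.finrank_fin_fun]; rfl) (A := (cone O).toFinset)
    (fun c hc u hu => by
      rw [Set.mem_toFinset] at hu ⊢
      exact smul_mem_cone hc hu)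
    (fun h => by
      rw [Set.mem_toFinset] at h
      exact h.1 rfl)
    (g := m * ((Fintype.card F : ℝ) - 1)) (mul_pos hm' (by linarith))
    (fun W hW hd => by
      have hgen := hO W ⟨(hti W).2 fun v hv w hw => hW hw v hv, hd⟩
      simp_rw [Set.mem_toFinset]
      rw [ncard_cone_inter, hgen, Nat.cast_mul, Nat.cast_sub Fintype.card_pos, Nat.cast_one])
  rw [ge_iff_le, div_le_iff₀ (by linarith)]
  have hsqrt : Real.sqrt (9 + 4 * ((Fintype.card F : ℝ) ^ r + (Fintype.card F : ℝ) - 2))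
      ≤ 2 * (m * ((Fintype.card F : ℝ) - 1)) + 3 := by
    have := mul_pos hm' (sub_pos.2 hq1)
    refine Real.sqrt_le_iff.2 ⟨by linarith, ?_⟩
    linarith
  linarith

end PolarOvoids
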